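/- arXiv:1809.04193 — 5 statements merged into one kernel-verified Lean document; each statement's English description precedes it below -/
import Mathlib

section
/- If a context assignment φ : Fin n → B is pairwise disjoint and φ' is obtained from φ by an unconditional-jump update at source index i with target index j (i.e., position i is set to ⊥ and the old value Φ = φ i is joined onto position j), then φ' is pairwise disjoint. (Induction step of the Disjoint Context Lemma, case of a VBlock with a single jump target.) -/
/-- Induction step of the Disjoint Context Lemma, unconditional-jump case:
if `φ` is pairwise disjoint and `φ'` is obtained from `φ` by setting position `i`
to `⊥` and joining the old value `Φ = φ i` onto position `j`, then `φ'` is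
pairwise disjoint. -/
theorem uncond_jump_preserves_disjoint {B : Type*} [BooleanAlgebra B] {n : ℕ}
    (hn : 0 < n) (φ : Fin n → B)
    (hdisj : ∀ a b : Fin n, a ≠ b → φ a ⊓ φ b = ⊥)
    (i j : Fin n) (φ' : Fin n → B)
    (hφ' : φ' = Function.update (Function.update φ i ⊥) j
        ((Function.update φ i ⊥) j ⊔ φ i)) :
    ∀ a b : Fin n, a ≠ b → φ' a ⊓ φ' b = ⊥ := by
  subst hφ'
  intro a b hab
  simp only [Function.update_apply]
  split_ifs <;>
    try simp only [inf_sup_right, inf_sup_left, bot_inf_eq, inf_bot_eq, bot_sup_eq, sup_eq_bot_iff]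
  all_goals grind
end

section
/- If a context assignment φ : Fin n → B is pairwise disjoint and φ' is obtained from φ by a conditional-jump update at source index i with distinct target indices j, k and split condition X : B (i.e., position i is set to ⊥, X ⊓ Φ is joined onto position j, and Xᶜ ⊓ Φ is joined onto position k, where Φ = φ i), then φ' is pairwise disjoint. (Induction step of the Disjoint Context Lemma, case of a VBlock with a conditional jump splitting on X.) -/
/-- Induction step of the Disjoint Context Lemma, conditional-jump case:
if `φ` is pairwise disjoint and `φ'` is obtained from `φ` by setting position `i`
to `⊥`, joining `X ⊓ Φ` onto position `j`, and joining `Xᶜ ⊓ Φ` onto position `k`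
(where `Φ = φ i` and `j ≠ k`), then `φ'` is pairwise disjoint. -/
theorem cond_jump_preserves_disjoint {B : Type*} [BooleanAlgebra B] {n : ℕ}
    (hn : 0 < n) (φ : Fin n → B)
    (hdisj : ∀ a b : Fin n, a ≠ b → φ a ⊓ φ b = ⊥)
    (i j k : Fin n) (hjk : j ≠ k) (X : B) (φ' : Fin n → B)
    (hφ' : φ' =
      (fun φ₁ => Function.update φ₁ k (φ₁ k ⊔ (Xᶜ ⊓ φ i)))
        ((fun ψ => Function.update ψ j (ψ j ⊔ (X ⊓ φ i)))
          (Function.update φ i ⊥))) :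
    ∀ a b : Fin n, a ≠ b → φ' a ⊓ φ' b = ⊥ := by
  intro a b hab
  set ψ := Function.update φ i ⊥ with hψ
  let s : Fin n → B := fun c => if c = k then Xᶜ else if c = j then X else ⊥
  have hφ's (c : Fin n) : φ' c = ψ c ⊔ (s c ⊓ φ i) := by
    by_cases hck : c = k
    · subst hck
      simp [hφ', s, Function.update_of_ne hjk.symm]
    · by_cases hcj : c = j
      · subst hcj
        simp [hφ', s, hck]
      · simp [hφ', s, hck, hcj]
  have hψφ (c : Fin n) : Disjoint (ψ c) (φ i) := by
    by_cases hci : c = i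
    · simp [hψ, hci]
    · simpa [hψ, hci, disjoint_iff] using hdisj c i hci
  have hψψ : Disjoint (ψ a) (ψ b) := by
    by_cases hai : a = i
    · simp [hψ, hai]
    by_cases hbi : b = i
    · simp [hψ, hbi]
    simpa [hψ, hai, hbi, disjoint_iff] using hdisj a b hab
  have hss : Disjoint (s a) (s b) := by
    simp only [s]
    split_ifs with hak hbk hbj haj hbk hbj
    · exact absurd (hak.trans hbk.symm) hab
    · exact disjoint_compl_left
    · exact disjoint_bot_right
    · exact disjoint_compl_right
    · exact absurd (haj.trans hbj.symm) hab
    · exact disjoint_bot_right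
    all_goals exact disjoint_bot_left
  rw [hφ's, hφ's, ← disjoint_iff, disjoint_sup_left, disjoint_sup_right, disjoint_sup_right]
  exact ⟨⟨hψψ, (hψφ a).mono_right inf_le_right⟩,
    ((hψφ b).mono_right inf_le_right).symm, hss.mono inf_le_left inf_le_left⟩
end

section
/- Disjoint Context Lemma: let the initial context assignment φ₀ : Fin n → B assign the method context m : B to a designated entry index i₀ and ⊥ to every other index, and let a propagation step be either an unconditional-jump update or a conditional-jump update. Then every context assignment reachable from φ₀ by a finite sequence of propagation steps (the reflexive-transitive closure of the step relation) is pairwise disjoint; that is, at any point of variational execution, the contexts of two different VBlocks are mutually exclusive. -/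
/-- The assignment obtained from `φ` by an unconditional-jump update with source
index `i` and target index `j`: position `i` is set to `⊥` and the old value
`Φ = φ i` is joined onto position `j`. -/
def UncondUpdate {B : Type*} [BooleanAlgebra B] {n : ℕ}
    (φ : Fin n → B) (i j : Fin n) : Fin n → B :=
  let ψ := Function.update φ i ⊥
  Function.update ψ j (ψ j ⊔ φ i)

/-- The assignment obtained from `φ` by a conditional-jump update with source
index `i`, target indices `j`, `k`, and split condition `X`: position `i` is set
to `⊥`, `X ⊓ Φ` is joined onto position `j`, and `Xᶜ ⊓ Φ` is joined onto
position `k`, where `Φ = φ i`. -/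
def CondUpdate {B : Type*} [BooleanAlgebra B] {n : ℕ}
    (φ : Fin n → B) (i j k : Fin n) (X : B) : Fin n → B :=
  let ψ := Function.update φ i ⊥
  let φ₁ := Function.update ψ j (ψ j ⊔ (X ⊓ φ i))
  Function.update φ₁ k (φ₁ k ⊔ (Xᶜ ⊓ φ i))

/-- A propagation step relates `φ` to any assignment obtained from `φ` by an
unconditional-jump update or a conditional-jump update (with distinct targets). -/
def PropStep {B : Type*} [BooleanAlgebra B] {n : ℕ}
    (φ φ' : Fin n → B) : Prop :=
  (∃ i j : Fin n, φ' = UncondUpdate φ i j) ∨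
  (∃ i j k : Fin n, ∃ X : B, j ≠ k ∧ φ' = CondUpdate φ i j k X)

section PairwiseDisjoint

variable {ι B : Type*} [DecidableEq ι] [BooleanAlgebra B] {φ : ι → B}

theorem pairwise_disjoint_update_bot (h : Pairwise fun a b => Disjoint (φ a) (φ b)) (i : ι) :
    Pairwise fun a b =>
      Disjoint (Function.update φ i ⊥ a) (Function.update φ i ⊥ b) := by
  intro a b hab
  simp only [Function.update_apply]
  split_ifs
  · exact disjoint_bot_left
  · exact disjoint_bot_left
  · exact disjoint_bot_right
  · exact h hab

theorem disjoint_update_bot (h : Pairwise fun a b => Disjoint (φ a) (φ b)) (i l : ι) :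
    Disjoint (φ i) (Function.update φ i ⊥ l) := by
  rw [Function.update_apply]
  split_ifs with hl
  · exact disjoint_bot_right
  · exact h (Ne.symm hl)

theorem pairwise_disjoint_update_sup (h : Pairwise fun a b => Disjoint (φ a) (φ b))
    (j : ι) {c : B} (hc : ∀ l, Disjoint c (φ l)) :
    Pairwise fun a b =>
      Disjoint (Function.update φ j (φ j ⊔ c) a) (Function.update φ j (φ j ⊔ c) b) := by
  intro a b hab
  simp only [Function.update_apply]
  split_ifs with ha hb hb
  · exact absurd (ha.trans hb.symm) hab
  · exact Disjoint.sup_left (h (Ne.symm hb)) (hc b)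
  · exact Disjoint.sup_right (h ha) (hc a).symm
  · exact h hab

theorem disjoint_update_sup {c d : B} (hd : ∀ l, Disjoint d (φ l)) (hdc : Disjoint d c)
    (j l : ι) : Disjoint d (Function.update φ j (φ j ⊔ c) l) := by
  rw [Function.update_apply]
  split_ifs
  · exact Disjoint.sup_right (hd j) hdc
  · exact hd l

end PairwiseDisjoint

theorem PropStep.pairwise_disjoint {B : Type*} [BooleanAlgebra B] {n : ℕ} {φ φ' : Fin n → B}
    (hstep : PropStep φ φ') (h : Pairwise fun a b => Disjoint (φ a) (φ b)) :
    Pairwise fun a b => Disjoint (φ' a) (φ' b) := by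
  rcases hstep with ⟨i, j, rfl⟩ | ⟨i, j, k, X, -, rfl⟩
  · exact pairwise_disjoint_update_sup (pairwise_disjoint_update_bot h i) j
      (disjoint_update_bot h i)
  · refine pairwise_disjoint_update_sup
      (pairwise_disjoint_update_sup (pairwise_disjoint_update_bot h i) j
        fun l => (disjoint_update_bot h i l).mono_left inf_le_right) k
      (disjoint_update_sup (fun l => (disjoint_update_bot h i l).mono_left inf_le_right) ?_ j)
    exact disjoint_compl_left.mono inf_le_left inf_le_left

/-- Disjoint Context Lemma: every context assignment reachable by propagation
steps from the initial assignment (method context `m` at the entry index `i₀`,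
`⊥` elsewhere) is pairwise disjoint. -/
theorem disjoint_context_lemma {B : Type*} [BooleanAlgebra B] {n : ℕ}
    (hn : 0 < n) (i₀ : Fin n) (m : B)
    (φ₀ : Fin n → B) (hφ₀ : φ₀ = fun i => if i = i₀ then m else ⊥)
    (φ : Fin n → B) (hreach : Relation.ReflTransGen PropStep φ₀ φ) :
    ∀ a b : Fin n, a ≠ b → φ a ⊓ φ b = ⊥ := by
  suffices h : Pairwise fun a b => Disjoint (φ a) (φ b) from
    fun a b hab => (h hab).eq_bot
  induction hreach with
  | refl =>
    subst hφ₀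
    intro a b hab
    dsimp only
    split_ifs with ha hb hb
    · exact absurd (ha.trans hb.symm) hab
    · exact disjoint_bot_right
    · exact disjoint_bot_left
    · exact disjoint_bot_left
  | tail _ hstep ih => exact hstep.pairwise_disjoint ih
end

section
/- Optimal sharing for a simple loop: let r be a deterministic relation on α, x : α, and let t₁, …, t_m (m ≥ 1) be nonempty r-traces all having head x. Then a member of the family of maximal length is a shortest common supersequence of the family: it is a common supersequence of t₁, …, t_m, and every common supersequence of t₁, …, t_m has length at least the maximum of the lengths of the t_i. -/
/-- Of two traces of a deterministic relation starting at the same point, the shorter one is a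
prefix of the longer one. -/
theorem List.IsChain.prefix_of_length_le {α : Type*} {r : α → α → Prop}
    (hdet : ∀ a b c : α, r a b → r a c → b = c) {x : α} {l₁ l₂ : List α}
    (h₁ : (x :: l₁).IsChain r) (h₂ : (x :: l₂).IsChain r) (hle : l₁.length ≤ l₂.length) :
    x :: l₁ <+: x :: l₂ := by
  induction l₁ generalizing x l₂ with
  | nil => simp
  | cons a l₁ ih =>
    cases l₂ with
    | nil => simp at hle
    | cons b l₂ =>
      rw [List.isChain_cons_cons] at h₁ h₂
      obtain rfl := hdet x a b h₁.1 h₂.1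
      exact (List.prefix_cons_inj x).2 (ih h₁.2 h₂.2 (by simpa using hle))


/-- Optimal sharing for a simple loop: among nonempty traces of a deterministic
relation that all start at `x`, a member of maximal length is a common
supersequence of the family, and every common supersequence of the family has
length at least the maximum of the lengths. -/
theorem longest_trace_is_shortest_common_supersequence {α : Type*}
    (r : α → α → Prop) (hdet : ∀ a b c : α, r a b → r a c → b = c)
    (x : α) (m : ℕ) (hm : 1 ≤ m) (t : Fin m → List α)
    (hne : ∀ i, t i ≠ []) (hc : ∀ i, List.Chain' r (t i))
    (hhead : ∀ i, (t i).head (hne i) = x)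
    (i₀ : Fin m) (hmax : ∀ i, (t i).length ≤ (t i₀).length) :
    (∀ i, (t i).Sublist (t i₀)) ∧
      ∀ s : List α, (∀ i, (t i).Sublist s) → (t i₀).length ≤ s.length := by
  refine ⟨fun i => ?_, fun s hs => (hs i₀).length_le⟩
  have key : ∀ i, ∃ l, t i = x :: l := fun i =>
    ⟨(t i).tail, by rw [← hhead i, List.cons_head_tail]⟩
  obtain ⟨l₁, h₁⟩ := key i
  obtain ⟨l₂, h₂⟩ := key i₀
  have hc₁ := hc i
  have hc₂ := hc i₀
  have hle := hmax i
  rw [h₁] at hc₁ hle ⊢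
  rw [h₂] at hc₂ hle ⊢
  exact (List.IsChain.prefix_of_length_le hdet hc₁ hc₂ (by simpa using hle)).sublist
end

section
/- Optimal sharing for acyclic control flow, abstract form: let t₁, …, t_m be lists over α and let t_v be a common supersequence of t₁, …, t_m such that t_v has no duplicate elements (t_v.Nodup) and every element of t_v occurs in at least one t_i. Then t_v is a shortest common supersequence of t₁, …, t_m: every common supersequence s of t₁, …, t_m satisfies length s ≥ length t_v. (A duplicate-free variational trace covering exactly the executed VBlocks achieves the optimal alignment length.) -/
/-- Optimal sharing for acyclic control flow, abstract form: a duplicate-free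
common supersequence `t_v` of the traces, each of whose elements occurs in some
trace, is a shortest common supersequence. -/
theorem nodup_cover_is_shortest_common_supersequence {α : Type*} [DecidableEq α]
    (m : ℕ) (t : Fin m → List α) (tv : List α)
    (hsup : ∀ i, (t i).Sublist tv)
    (hnodup : tv.Nodup)
    (hcover : ∀ a ∈ tv, ∃ i, a ∈ t i) :
    ∀ s : List α, (∀ i, (t i).Sublist s) → tv.length ≤ s.length := by
  intro s hs
  refine (hnodup.subperm fun a ha => ?_).length_le
  obtain ⟨i, hi⟩ := hcover a ha
  exact (hs i).subset hi
end
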